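/- Let Ω ⊂ ℝ^{n+1} be a bounded open set with smooth boundary, k > 1, c₀ > 0. Suppose u^ε ∈ C^∞(closure(Ω)) solves the regularized levelset equation div(Du^ε/√(ε² + |Du^ε|²)) = −(ε² + |Du^ε|²)^{−1/(2k)} in Ω with u^ε = 0 on ∂Ω and ‖u^ε‖_{C¹(closure(Ω))} ≤ c₀. Then there is a constant c = c(n, Ω, k, c₀) > 0 such that for all sufficiently small ε > 0 the H^{2,2}(Ω) norm of u^ε, namely (∫_Ω (|u^ε|² + |Du^ε|² + |D²u^ε|²))^{1/2}, is at most c ε^{−(4 + 1/k)}. -/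

import Mathlib

open MeasureTheory Filter Bornology
open scoped BigOperators Topology

noncomputable section

/-- Euclidean space `ℝ^{n+1}`. -/
abbrev Euc (n : ℕ) : Type := EuclideanSpace ℝ (Fin (n + 1))

/-- The partial derivative `D_i u` at `x`. -/
def pd (n : ℕ) (u : Euc n → ℝ) (i : Fin (n + 1)) (x : Euc n) : ℝ :=
  fderiv ℝ u x (EuclideanSpace.single i 1)

/-- The second partial derivative `D_i D_j u` at `x`. -/
def pd2 (n : ℕ) (u : Euc n → ℝ) (i j : Fin (n + 1)) (x : Euc n) : ℝ :=
  pd n (pd n u j) i x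

/-- The squared euclidean norm `|Du|²` of the gradient at `x`. -/
def gradSq (n : ℕ) (u : Euc n → ℝ) (x : Euc n) : ℝ :=
  ∑ i, (pd n u i x) ^ 2

/-- `u` is a (test-function) viscosity subsolution of the levelset power mean curvature
flow equation `div(Du/|Du|) = −|Du|^{−1/k}` on `Ω`. -/
def IsViscSubsolution (n : ℕ) (k : ℝ) (Ω : Set (Euc n)) (u : Euc n → ℝ) : Prop :=
  ∀ φ : Euc n → ℝ, ContDiffOn ℝ (⊤ : ℕ∞) φ Ω → ∀ x₀ ∈ Ω,
    IsLocalMaxOn (fun x => u x - φ x) Ω x₀ →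
    ((gradSq n φ x₀ ≠ 0 →
        (-(Real.sqrt (gradSq n φ x₀) ^ (1 / k - 1))) *
          (∑ i, ∑ j, ((if i = j then (1 : ℝ) else 0) -
            pd n φ i x₀ * pd n φ j x₀ / gradSq n φ x₀) * pd2 n φ i j x₀) ≤ 1) ∧
      (gradSq n φ x₀ = 0 →
        ∃ η : Euc n, ‖η‖ ≤ 1 ∧
          (-(∑ i, ∑ j, ((if i = j then (1 : ℝ) else 0) - η i * η j) *
            pd2 n φ i j x₀)) ≤ 0))

/-- `u` is a (test-function) viscosity supersolution of the levelset power mean curvature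
flow equation `div(Du/|Du|) = −|Du|^{−1/k}` on `Ω`. -/
def IsViscSupersolution (n : ℕ) (k : ℝ) (Ω : Set (Euc n)) (u : Euc n → ℝ) : Prop :=
  ∀ φ : Euc n → ℝ, ContDiffOn ℝ (⊤ : ℕ∞) φ Ω → ∀ x₀ ∈ Ω,
    IsLocalMinOn (fun x => u x - φ x) Ω x₀ →
    ((gradSq n φ x₀ ≠ 0 →
        1 ≤ (-(Real.sqrt (gradSq n φ x₀) ^ (1 / k - 1))) *
          (∑ i, ∑ j, ((if i = j then (1 : ℝ) else 0) -
            pd n φ i x₀ * pd n φ j x₀ / gradSq n φ x₀) * pd2 n φ i j x₀)) ∧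
      (gradSq n φ x₀ = 0 →
        ∃ η : Euc n, ‖η‖ ≤ 1 ∧
          0 ≤ (-(∑ i, ∑ j, ((if i = j then (1 : ℝ) else 0) - η i * η j) *
            pd2 n φ i j x₀))))

/-- `u` is a viscosity solution: both a viscosity subsolution and supersolution. -/
def IsViscSolution (n : ℕ) (k : ℝ) (Ω : Set (Euc n)) (u : Euc n → ℝ) : Prop :=
  IsViscSubsolution n k Ω u ∧ IsViscSupersolution n k Ω u

/-- `u` solves the regularized levelset equation
`div(Du/√(ε² + |Du|²)) = −(ε² + |Du|²)^{−1/(2k)}` in `Ω`. -/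
def SolvesReg (n : ℕ) (k ε : ℝ) (Ω : Set (Euc n)) (u : Euc n → ℝ) : Prop :=
  ∀ x ∈ Ω,
    (∑ i, pd n (fun y => pd n u i y / Real.sqrt (ε ^ 2 + gradSq n u y)) i x) =
      -((ε ^ 2 + gradSq n u x) ^ (-(1 / (2 * k))))

/-- `Ω` is a domain with smooth boundary: the sublevel set of a smooth function with
nonvanishing gradient on the boundary. -/
def HasSmoothBoundary (n : ℕ) (Ω : Set (Euc n)) : Prop :=
  ∃ f : Euc n → ℝ, ContDiff ℝ (⊤ : ℕ∞) f ∧ Ω = {x | f x < 0} ∧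
    ∀ x ∈ frontier Ω, fderiv ℝ f x ≠ 0

section Geometry

variable {n : ℕ} {f : Euc n → ℝ}

/-- Near a point of `{f = 0}`, moving in a direction along which `f` decreases enters `{f < 0}`. -/
lemma eventually_add_smul_neg {y w : Euc n} (hf : DifferentiableAt ℝ f y) (hy : f y = 0)
    (hw : fderiv ℝ f y w < 0) : ∀ᶠ t : ℝ in 𝓝[>] 0, f (y + t • w) < 0 := by
  have hd : HasDerivAt (fun t : ℝ => f (y + t • w)) (fderiv ℝ f y w) 0 :=
    hf.hasFDerivAt.hasLineDerivAt w
  have h := hd.tendsto_slope_zero_right.eventually (gt_mem_nhds hw)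
  filter_upwards [h, self_mem_nhdsWithin] with t ht ht0
  have ht0 : (0 : ℝ) < t := ht0
  simp only [zero_add, zero_smul, add_zero, hy, sub_zero, smul_eq_mul] at ht
  by_contra hcon
  exact absurd ht (not_lt.2 (mul_nonneg (inv_nonneg.2 ht0.le) (not_lt.1 hcon)))

lemma exists_fderiv_neg {y : Euc n} (hy : fderiv ℝ f y ≠ 0) : ∃ w, fderiv ℝ f y w < 0 := by
  by_contra! h
  apply hy
  ext w
  have h1 := h w
  have h2 := h (-w)
  rw [map_neg] at h2
  simpa using le_antisymm (by linarith) h1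

lemma mem_frontier_sublevel (hf : ContDiff ℝ (⊤ : ℕ∞) f) {y : Euc n} (hy : f y = 0)
    (hy' : fderiv ℝ f y ≠ 0) : y ∈ frontier {x | f x < 0} := by
  obtain ⟨w, hw⟩ := exists_fderiv_neg hy'
  have ho : IsOpen {x | f x < 0} := isOpen_lt hf.continuous continuous_const
  rw [frontier, ho.interior_eq]
  refine ⟨?_, by simp [hy]⟩
  have h := eventually_add_smul_neg (hf.differentiable (by simp) y) hy hw
  have ht : Tendsto (fun t : ℝ => y + t • w) (𝓝[>] 0) (𝓝 y) := by
    have : Tendsto (fun t : ℝ => y + t • w) (𝓝 0) (𝓝 (y + (0 : ℝ) • w)) :=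
      Continuous.tendsto (by fun_prop) 0
    rw [zero_smul, add_zero] at this
    exact this.mono_left nhdsWithin_le_nhds
  exact mem_closure_of_tendsto ht h

lemma eq_zero_of_mem_frontier_sublevel (hf : Continuous f) {y : Euc n}
    (hy : y ∈ frontier {x | f x < 0}) : f y = 0 :=
  frontier_lt_subset_eq hf continuous_const hy

lemma nonpos_of_mem_closure_sublevel (hf : Continuous f) {y : Euc n}
    (hy : y ∈ closure {x | f x < 0}) : f y ≤ 0 :=
  closure_lt_subset_le hf continuous_const hy

lemma uniqueDiffOn_closure_sublevel (hf : ContDiff ℝ (⊤ : ℕ∞) f)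
    (hf' : ∀ x ∈ frontier {x | f x < 0}, fderiv ℝ f x ≠ 0) :
    UniqueDiffOn ℝ (closure {x | f x < 0}) := by
  have ho : IsOpen {x | f x < 0} := isOpen_lt hf.continuous continuous_const
  intro x hx
  by_cases hxΩ : x ∈ {x | f x < 0}
  · exact uniqueDiffWithinAt_of_mem_nhds (mem_of_superset (ho.mem_nhds hxΩ) subset_closure)
  have hxf : x ∈ frontier {x | f x < 0} := by
    rw [frontier, ho.interior_eq]; exact ⟨hx, hxΩ⟩
  have hx0 := eq_zero_of_mem_frontier_sublevel hf.continuous hxf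
  refine ⟨?_, subset_closure hx⟩
  have hsub : {w | fderiv ℝ f x w < 0} ⊆ tangentConeAt ℝ (closure {x | f x < 0}) x := by
    intro w hw
    refine mem_tangentConeAt_of_add_smul_mem (α := ℝ) (l := 𝓝[>] 0) (c := id)
      (tendsto_id'.mpr <| nhdsGT_le_nhdsNE 0) ?_
    filter_upwards [eventually_add_smul_neg (hf.differentiable (by simp) x) hx0 hw] with t ht
    exact subset_closure ht
  obtain ⟨w, hw⟩ := exists_fderiv_neg (hf' x hxf)
  have hopen : IsOpen {w | fderiv ℝ f x w < 0} :=
    isOpen_lt (fderiv ℝ f x).continuous continuous_const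
  have htop : Submodule.span ℝ (tangentConeAt ℝ (closure {x | f x < 0}) x) = ⊤ :=
    Submodule.eq_top_of_nonempty_interior' _
      ⟨w, interior_mono (hsub.trans Submodule.subset_span) (hopen.interior_eq.symm ▸ hw)⟩
  rw [htop]
  exact dense_univ

/-- The within-derivative of a function vanishing on the boundary annihilates the tangent space. -/
lemma fderivWithin_eq_zero_of_tangent (hf : ContDiff ℝ (⊤ : ℕ∞) f)
    {x : Euc n} (hx : x ∈ frontier {x | f x < 0}) (hx' : fderiv ℝ f x ≠ 0)
    {h : Euc n → ℝ} {h' : Euc n →L[ℝ] ℝ}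
    (hh : HasFDerivWithinAt h h' (closure {x | f x < 0}) x)
    (h0 : ∀ y ∈ frontier {x | f x < 0}, h y = 0) {τ : Euc n} (hτ : fderiv ℝ f x τ = 0) :
    h' τ = 0 := by
  have hs : HasStrictFDerivAt f (fderiv ℝ f x) x :=
    hf.contDiffAt.hasStrictFDerivAt (by simp)
  have hr : (fderiv ℝ f x).range = ⊤ := by
    refine LinearMap.range_eq_top.2 ?_
    obtain ⟨w, hw⟩ := exists_fderiv_neg hx'
    exact LinearMap.surjective (fun h0 => by
      have := LinearMap.congr_fun h0 w
      simp at this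
      exact hw.ne this)
  have hx0 := eq_zero_of_mem_frontier_sublevel hf.continuous hx
  let g := hs.implicitFunction f (fderiv ℝ f x) hr (f x)
  have hg : HasStrictFDerivAt g (fderiv ℝ f x).ker.subtypeL 0 := hs.to_implicitFunction hr
  have hg0 : g 0 = x := hs.implicitFunction_apply_image hr
  let τ' : (fderiv ℝ f x).ker := ⟨τ, hτ⟩
  let y : ℝ → Euc n := fun t => g (t • τ')
  have hy0 : y 0 = x := by simp [y, hg0]
  have hyd : HasDerivAt y τ 0 := by
    have h1 : HasDerivAt (fun t : ℝ => t • τ') τ' 0 := by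
      simpa using (hasDerivAt_id (0 : ℝ)).smul_const τ'
    have h2 : HasFDerivAt g (fderiv ℝ f x).ker.subtypeL ((0 : ℝ) • τ') := by
      rw [zero_smul]; exact hg.hasFDerivAt
    exact h2.comp_hasDerivAt 0 h1
  have hyt : Tendsto y (𝓝 0) (𝓝 x) := by
    have := hyd.continuousAt.tendsto
    rwa [hy0] at this
  have hyf : ∀ᶠ t in 𝓝 (0 : ℝ), f (y t) = 0 := by
    have h1 := hs.map_implicitFunction_eq hr
    have h2 : Tendsto (fun t : ℝ => (f x, t • τ')) (𝓝 0) (𝓝 (f x, 0)) := by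
      have : Continuous (fun t : ℝ => (f x, t • τ')) := by fun_prop
      have := this.tendsto 0
      rwa [zero_smul] at this
    filter_upwards [h2.eventually h1] with t ht
    rw [← hx0]
    exact ht
  have hyn : ∀ᶠ t in 𝓝 (0 : ℝ), fderiv ℝ f (y t) ≠ 0 :=
    hyt.eventually (((hf.continuous_fderiv (by simp)).continuousAt).eventually_ne hx')
  have hyfr : ∀ᶠ t in 𝓝 (0 : ℝ), y t ∈ frontier {x | f x < 0} := by
    filter_upwards [hyf, hyn] with t h1 h2 using mem_frontier_sublevel hf h1 h2
  have hcomp : HasDerivAt (h ∘ y) (h' τ) 0 := by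
    rw [← hy0] at hh
    have hm : ∀ᶠ t in 𝓝 (0 : ℝ), y t ∈ closure {x | f x < 0} :=
      hyfr.mono fun t ht => frontier_subset_closure ht
    exact (hh.comp_hasDerivWithinAt (s := y ⁻¹' closure {x | f x < 0}) 0 hyd.hasDerivWithinAt
      (Set.mapsTo_preimage _ _)).hasDerivAt hm
  have hz : HasDerivAt (h ∘ y) 0 0 :=
    (hasDerivAt_const (0 : ℝ) (0 : ℝ)).congr_of_eventuallyEq
      (hyfr.mono fun t ht => h0 _ ht)
  exact hcomp.unique hz

/-- The tangential operators `f_i D_j - f_j D_i` kill functions vanishing on the boundary. -/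
lemma tangential_derivative_eq_zero (hf : ContDiff ℝ (⊤ : ℕ∞) f)
    {x : Euc n} (hx : x ∈ frontier {x | f x < 0}) (hx' : fderiv ℝ f x ≠ 0)
    {h : Euc n → ℝ} {h' : Euc n →L[ℝ] ℝ}
    (hh : HasFDerivWithinAt h h' (closure {x | f x < 0}) x)
    (h0 : ∀ y ∈ frontier {x | f x < 0}, h y = 0) (i j : Fin (n + 1)) :
    pd n f i x * h' (EuclideanSpace.single j 1) = pd n f j x * h' (EuclideanSpace.single i 1) := by
  have := fderivWithin_eq_zero_of_tangent hf hx hx' hh h0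
    (τ := pd n f i x • EuclideanSpace.single j 1 - pd n f j x • EuclideanSpace.single i 1)
    (by simp only [map_sub, map_smul, smul_eq_mul, pd]; ring)
  simp only [map_sub, map_smul, smul_eq_mul] at this
  linarith

/-- A strict upper bound on the boundary persists in a boundary layer. -/
lemma exists_boundary_layer (hf : Continuous f) (hb : IsBounded {x | f x < 0})
    {φ : Euc n → ℝ} (hφ : ContinuousOn φ (closure {x | f x < 0})) {A : ℝ}
    (hA : ∀ x ∈ frontier {x | f x < 0}, φ x < A) :
    ∃ δ > 0, ∀ x, f x < 0 → -δ ≤ f x → φ x < A := by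
  have ho : IsOpen {x | f x < 0} := isOpen_lt hf continuous_const
  have hK : IsCompact (closure {x | f x < 0}) := hb.isCompact_closure
  have hc : IsCompact (closure {x | f x < 0} ∩ φ ⁻¹' Set.Ici A) :=
    hK.of_isClosed_subset (hφ.preimage_isClosed_of_isClosed isClosed_closure isClosed_Ici)
      Set.inter_subset_left
  obtain ⟨a, ha, ha'⟩ := hc.exists_forall_le' (f := fun x => -f x) (a := 0)
    (hf.neg.continuousOn) (by
      rintro x ⟨hx, hxA⟩
      have h1 := nonpos_of_mem_closure_sublevel hf hx
      rcases h1.lt_or_eq with h2 | h2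
      · linarith
      · have : x ∈ frontier {x | f x < 0} := by
          rw [frontier, ho.interior_eq]; exact ⟨hx, by simp [h2]⟩
        exact absurd (hA x this) (not_lt.2 hxA))
  refine ⟨a / 2, by positivity, fun x hx hxa => ?_⟩
  by_contra hcon
  have := ha' x ⟨subset_closure hx, not_lt.1 hcon⟩
  linarith

end Geometry

section IntegrationByParts

variable {n : ℕ} {Ω : Set (Euc n)}

lemma pd_eq_of_eqOn (hΩ : IsOpen Ω) {g h : Euc n → ℝ} (hgh : Set.EqOn g h Ω) {x : Euc n}
    (hx : x ∈ Ω) (i : Fin (n + 1)) : pd n g i x = pd n h i x := by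
  have : g =ᶠ[𝓝 x] h := mem_of_superset (hΩ.mem_nhds hx) hgh
  rw [pd, pd, this.fderiv_eq]

lemma contDiffOn_pd (hΩ : IsOpen Ω) {g : Euc n → ℝ} (hg : ContDiffOn ℝ (⊤ : ℕ∞) g Ω)
    (i : Fin (n + 1)) : ContDiffOn ℝ (⊤ : ℕ∞) (pd n g i) Ω :=
  (hg.fderiv_of_isOpen hΩ (by simp)).clm_apply contDiffOn_const

lemma differentiableAt_of_contDiffOn (hΩ : IsOpen Ω) {g : Euc n → ℝ}
    (hg : ContDiffOn ℝ (⊤ : ℕ∞) g Ω) {x : Euc n} (hx : x ∈ Ω) : DifferentiableAt ℝ g x :=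
  (hg.contDiffAt (hΩ.mem_nhds hx)).differentiableAt (by simp)

lemma pd2_comm (hΩ : IsOpen Ω) {g : Euc n → ℝ} (hg : ContDiffOn ℝ (⊤ : ℕ∞) g Ω)
    {x : Euc n} (hx : x ∈ Ω) (i j : Fin (n + 1)) : pd2 n g i j x = pd2 n g j i x := by
  have hc := hg.contDiffAt (hΩ.mem_nhds hx)
  have hs : IsSymmSndFDerivAt ℝ g x := hc.isSymmSndFDerivAt (by
    rw [minSmoothness_of_isRCLikeNormedField]; exact WithTop.coe_le_coe.2 (le_top : (2 : ℕ∞) ≤ ⊤))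
  have hd : DifferentiableAt ℝ (fderiv ℝ g) x :=
    (hc.fderiv_right (m := 1) (by norm_cast)).differentiableAt (by simp)
  have key : ∀ a b : Fin (n + 1), pd2 n g a b x =
      fderiv ℝ (fderiv ℝ g) x (EuclideanSpace.single a 1) (EuclideanSpace.single b 1) := by
    intro a b
    unfold pd2 pd
    rw [fderiv_clm_apply hd (by fun_prop)]
    simp
  rw [key, key, hs.eq]

lemma pd_mul (hΩ : IsOpen Ω) {g h : Euc n → ℝ} (hg : ContDiffOn ℝ (⊤ : ℕ∞) g Ω)
    (hh : ContDiffOn ℝ (⊤ : ℕ∞) h Ω) {x : Euc n} (hx : x ∈ Ω) (i : Fin (n + 1)) :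
    pd n (fun y => g y * h y) i x = pd n g i x * h x + g x * pd n h i x := by
  unfold pd
  rw [fderiv_fun_mul (differentiableAt_of_contDiffOn hΩ hg hx)
    (differentiableAt_of_contDiffOn hΩ hh hx)]
  simp
  ring

lemma integrable_mul_of_tsupport_subset (hΩ : IsOpen Ω) {η h : Euc n → ℝ} (hη : Continuous η)
    (hc : HasCompactSupport η) (hs : tsupport η ⊆ Ω) (hh : ContinuousOn h Ω) :
    Integrable (fun x => η x * h x) := by
  refine Continuous.integrable_of_hasCompactSupport ?_ hc.mul_right
  refine continuous_of_tsupport fun x hx => ?_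
  have hxη : x ∈ tsupport η := tsupport_mul_subset_left hx
  exact hη.continuousAt.mul (hh.continuousAt (hΩ.mem_nhds (hs hxη)))

lemma integral_mul_pd (hΩ : IsOpen Ω) {η g : Euc n → ℝ} (hη : ContDiff ℝ (⊤ : ℕ∞) η)
    (hc : HasCompactSupport η) (hs : tsupport η ⊆ Ω) (hg : ContDiffOn ℝ (⊤ : ℕ∞) g Ω)
    (i : Fin (n + 1)) : ∫ x, η x * pd n g i x = -∫ x, pd n η i x * g x := by
  have hs' : tsupport (pd n η i) ⊆ tsupport η := tsupport_fderiv_apply_subset ℝ _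
  refine integral_mul_fderiv_eq_neg_fderiv_mul_of_integrable ?_ ?_ ?_ ?_ ?_
  · exact integrable_mul_of_tsupport_subset hΩ
      (contDiffOn_univ.1 (contDiffOn_pd isOpen_univ hη.contDiffOn i)).continuous
      (hc.fderiv_apply ℝ _) (hs'.trans hs) hg.continuousOn
  · exact integrable_mul_of_tsupport_subset hΩ hη.continuous hc hs
      (contDiffOn_pd hΩ hg i).continuousOn
  · exact integrable_mul_of_tsupport_subset hΩ hη.continuous hc hs hg.continuousOn
  · exact fun x _ => hη.differentiable (by simp) x
  · exact fun x hx => differentiableAt_of_contDiffOn hΩ hg (hs hx)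

/-- The `2 × 2` Jacobian is a divergence, in weak form. -/
lemma integral_mul_jacobian (hΩ : IsOpen Ω) {η a b : Euc n → ℝ} (hη : ContDiff ℝ (⊤ : ℕ∞) η)
    (hc : HasCompactSupport η) (hs : tsupport η ⊆ Ω) (ha : ContDiffOn ℝ (⊤ : ℕ∞) a Ω)
    (hb : ContDiffOn ℝ (⊤ : ℕ∞) b Ω) (i j : Fin (n + 1)) :
    ∫ x, η x * (pd n a i x * pd n b j x - pd n a j x * pd n b i x) =
      ∫ x, a x * (pd n η j x * pd n b i x - pd n η i x * pd n b j x) := by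
  have hbi := contDiffOn_pd hΩ hb i
  have hbj := contDiffOn_pd hΩ hb j
  have hη' : ∀ l, Continuous (pd n η l) := fun l =>
    (contDiffOn_univ.1 (contDiffOn_pd isOpen_univ hη.contDiffOn l)).continuous
  have hs' : ∀ l, tsupport (pd n η l) ⊆ Ω := fun l =>
    (tsupport_fderiv_apply_subset ℝ _).trans hs
  have hc' : ∀ l, HasCompactSupport (pd n η l) := fun l => hc.fderiv_apply ℝ _
  have h1 := integral_mul_pd hΩ hη hc hs (ha.mul hbj) i
  have h2 := integral_mul_pd hΩ hη hc hs (ha.mul hbi) j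
  have e : ∀ x, η x * (pd n a i x * pd n b j x - pd n a j x * pd n b i x) =
      η x * pd n (fun y => a y * pd n b j y) i x - η x * pd n (fun y => a y * pd n b i y) j x := by
    intro x
    by_cases hx : x ∈ Ω
    · rw [pd_mul hΩ ha hbj hx, pd_mul hΩ ha hbi hx]
      have := pd2_comm hΩ hb hx i j
      unfold pd2 at this
      rw [this]
      ring
    · have : η x = 0 := image_eq_zero_of_notMem_tsupport fun h => hx (hs h)
      simp [this]
  simp_rw [e]
  rw [integral_sub]
  · erw [h1, h2]
    rw [neg_sub_neg, ← integral_sub]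
    · congr 1 with x
      ring
    · exact integrable_mul_of_tsupport_subset hΩ (hη' j) (hc' j) (hs' j) (ha.mul hbi).continuousOn
    · exact integrable_mul_of_tsupport_subset hΩ (hη' i) (hc' i) (hs' i) (ha.mul hbj).continuousOn
  · exact integrable_mul_of_tsupport_subset hΩ hη.continuous hc hs
      (contDiffOn_pd hΩ (ha.mul hbj) i).continuousOn
  · exact integrable_mul_of_tsupport_subset hΩ hη.continuous hc hs
      (contDiffOn_pd hΩ (ha.mul hbi) j).continuousOn

end IntegrationByParts

section Cutoff

variable {n : ℕ} {f : Euc n → ℝ} {δ : ℝ}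

/-- A smooth cutoff, supported in `{f ≤ -δ}` and equal to one on `{f ≤ -2δ}`. -/
def cutoff (f : Euc n → ℝ) (δ : ℝ) (x : Euc n) : ℝ := Real.smoothTransition (-f x / δ - 1)

/-- The profile `γ` with `D(cutoff) = -γ Df`. -/
def cutoffDensity (f : Euc n → ℝ) (δ : ℝ) (x : Euc n) : ℝ :=
  deriv Real.smoothTransition (-f x / δ - 1) / δ

lemma contDiff_cutoff (hf : ContDiff ℝ (⊤ : ℕ∞) f) : ContDiff ℝ (⊤ : ℕ∞) (cutoff f δ) :=
  Real.smoothTransition.contDiff.comp ((hf.neg.div_const δ).sub contDiff_const)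

lemma continuous_cutoffDensity (hf : Continuous f) : Continuous (cutoffDensity f δ) := by
  have h : Continuous (deriv Real.smoothTransition) :=
    (Real.smoothTransition.contDiff (n := 1)).continuous_deriv le_rfl
  unfold cutoffDensity
  fun_prop

lemma pd_cutoff (hf : ContDiff ℝ (⊤ : ℕ∞) f) (i : Fin (n + 1)) (x : Euc n) :
    pd n (cutoff f δ) i x = -(cutoffDensity f δ x * pd n f i x) := by
  have hd : HasDerivAt Real.smoothTransition (deriv Real.smoothTransition (-f x / δ - 1))
      (-f x / δ - 1) :=
    ((Real.smoothTransition.contDiff (n := 1)).differentiable (by simp) _).hasDerivAt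
  have hg : HasFDerivAt (fun y => -f y / δ - 1) (-(δ⁻¹ • fderiv ℝ f x)) x := by
    have := (((hf.differentiable (by simp) x).hasFDerivAt.neg).mul_const δ⁻¹).sub_const 1
    simpa [div_eq_mul_inv] using this
  have h := hd.comp_hasFDerivAt x hg
  have h' : fderiv ℝ (cutoff f δ) x = _ := h.fderiv
  unfold pd
  rw [h']
  simp [cutoffDensity]
  ring

lemma cutoff_nonneg (x : Euc n) : 0 ≤ cutoff f δ x := Real.smoothTransition.nonneg _

lemma cutoff_le_one (x : Euc n) : cutoff f δ x ≤ 1 := Real.smoothTransition.le_one _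

lemma cutoffDensity_nonneg (hδ : 0 < δ) (x : Euc n) : 0 ≤ cutoffDensity f δ x :=
  div_nonneg Real.smoothTransition.monotone.deriv_nonneg hδ.le

lemma cutoff_eq_zero (hδ : 0 < δ) {x : Euc n} (hx : -δ < f x) : cutoff f δ x = 0 := by
  apply Real.smoothTransition.zero_of_nonpos
  rw [sub_nonpos, div_le_one hδ]
  linarith

lemma cutoff_eq_one (hδ : 0 < δ) {x : Euc n} (hx : f x ≤ -(2 * δ)) : cutoff f δ x = 1 := by
  apply Real.smoothTransition.one_of_one_le
  rw [le_sub_iff_add_le, le_div_iff₀ hδ]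
  linarith

lemma cutoffDensity_eq_zero_of_lt (hδ : 0 < δ) {x : Euc n} (hx : -δ < f x) :
    cutoffDensity f δ x = 0 := by
  have h : -f x / δ - 1 < 0 := by
    rw [sub_neg, div_lt_one hδ]; linarith
  have he : Real.smoothTransition =ᶠ[𝓝 (-f x / δ - 1)] fun _ => 0 := by
    filter_upwards [gt_mem_nhds h] with t ht using Real.smoothTransition.zero_of_nonpos ht.le
  simp [cutoffDensity, he.deriv_eq]

lemma cutoffDensity_eq_zero_of_lt_neg (hδ : 0 < δ) {x : Euc n} (hx : f x < -(2 * δ)) :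
    cutoffDensity f δ x = 0 := by
  have h : 1 < -f x / δ - 1 := by
    rw [lt_sub_iff_add_lt, lt_div_iff₀ hδ]; linarith
  have he : Real.smoothTransition =ᶠ[𝓝 (-f x / δ - 1)] fun _ => 1 := by
    filter_upwards [lt_mem_nhds h] with t ht using Real.smoothTransition.one_of_one_le ht.le
  simp [cutoffDensity, he.deriv_eq]

lemma tsupport_subset_of_eq_zero (hf : Continuous f) {g : Euc n → ℝ}
    (hg : ∀ x, -δ < f x → g x = 0) : tsupport g ⊆ {x | f x ≤ -δ} := by
  refine closure_minimal (fun x hx => ?_) (isClosed_le hf continuous_const)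
  by_contra h
  exact hx (hg x (not_le.1 h))

lemma hasCompactSupport_of_eq_zero (hf : Continuous f) (hb : IsBounded {x | f x < 0})
    (hδ : 0 < δ) {g : Euc n → ℝ} (hg : ∀ x, -δ < f x → g x = 0) : HasCompactSupport g := by
  refine Metric.isCompact_of_isClosed_isBounded (isClosed_tsupport g) (hb.subset ?_)
  intro x hx
  have : f x ≤ -δ := tsupport_subset_of_eq_zero hf hg hx
  show f x < 0
  linarith

lemma tendsto_cutoff {x : Euc n} (hx : f x < 0) :
    Tendsto (fun δ => cutoff f δ x) (𝓝[>] 0) (𝓝 1) := by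
  refine tendsto_const_nhds.congr' ?_
  have h : ∀ᶠ δ : ℝ in 𝓝[>] 0, δ < -f x / 2 :=
    nhdsWithin_le_nhds (gt_mem_nhds (by linarith))
  filter_upwards [h, self_mem_nhdsWithin] with δ h1 h2
  exact (cutoff_eq_one h2 (by linarith)).symm

end Cutoff

section BoundaryTerm

/-- Algebraic form of the boundary integrand for a field normal to the boundary: it contains no
derivatives of the field. -/
lemma boundary_term_identity {ι : Type*} [Fintype ι] (X p : ι → ℝ) (V F : ι → ι → ℝ)
    (hX : ∀ i j, X i * p j = X j * p i)
    (hV : ∀ i j l, p i * (V j j * p l + X j * F j l - V j l * p j - X l * F j j) =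
      p j * (V i j * p l + X j * F i l - V i l * p j - X l * F i j)) :
    (∑ l, p l ^ 2) * ∑ i, ∑ j, X i * (p i * V j j - p j * V i j) =
      (∑ l, X l * p l) * ∑ i, ∑ j, X i * (p i * F j j - p j * F i j) := by
  let A : ι → ι → ι → ℝ := fun l i j =>
    X i * p i * p j * p l * V j l - X i * X j * p i * p l * F j l
  have key : ∀ l i j, p l ^ 2 * (X i * (p i * V j j - p j * V i j)) -
      X l * p l * (X i * (p i * F j j - p j * F i j)) = A l i j - A l j i := by
    intro l i j
    simp only [A]
    linear_combination X i * p l * hV i j l - p l * p j * V i l * hX i j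
  rw [← sub_eq_zero, Finset.sum_mul, Finset.sum_mul, ← Finset.sum_sub_distrib]
  refine Finset.sum_eq_zero fun l _ => ?_
  simp_rw [Finset.mul_sum, ← Finset.sum_sub_distrib, key, Finset.sum_sub_distrib]
  rw [sub_eq_zero]
  exact Finset.sum_comm

lemma abs_boundary_term_le {ι : Type*} [Fintype ι] (X p : ι → ℝ) (F : ι → ι → ℝ)
    (hX : ∀ i, |X i| ≤ 1) :
    |(∑ l, X l * p l) * ∑ i, ∑ j, X i * (p i * F j j - p j * F i j)| ≤
      (∑ l, |p l|) * ∑ i, ∑ j, (|p i * F j j - p j * F i j|) := by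
  have hmul : ∀ i (r : ℝ), |X i * r| ≤ |r| := fun i r => by
    rw [abs_mul]
    exact mul_le_of_le_one_left (abs_nonneg r) (hX i)
  rw [abs_mul]
  refine mul_le_mul ?_ ?_ (abs_nonneg _) (Finset.sum_nonneg fun _ _ => abs_nonneg _)
  · exact (Finset.abs_sum_le_sum_abs _ _).trans (Finset.sum_le_sum fun l _ => hmul l _)
  · refine (Finset.abs_sum_le_sum_abs _ _).trans (Finset.sum_le_sum fun i _ => ?_)
    exact (Finset.abs_sum_le_sum_abs _ _).trans (Finset.sum_le_sum fun j _ => hmul i _)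

variable {n : ℕ} {f : Euc n → ℝ}

lemma gradSq_pos {x : Euc n} (hx : fderiv ℝ f x ≠ 0) : 0 < gradSq n f x := by
  refine lt_of_le_of_ne (Finset.sum_nonneg fun i _ => sq_nonneg _) fun h => hx ?_
  have h0 : ∀ i, pd n f i x = 0 := fun i => by
    have := (Finset.sum_eq_zero_iff_of_nonneg (fun i _ => sq_nonneg (pd n f i x))).1 h.symm i
      (Finset.mem_univ i)
    exact pow_eq_zero_iff (two_ne_zero) |>.1 this
  have : (fderiv ℝ f x : Euc n →ₗ[ℝ] ℝ) = 0 :=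
    (EuclideanSpace.basisFun (Fin (n + 1)) ℝ).toBasis.ext fun i => by
      simpa [pd] using h0 i
  ext w
  exact LinearMap.congr_fun this w

lemma continuous_pd (hf : ContDiff ℝ (⊤ : ℕ∞) f) (i : Fin (n + 1)) : Continuous (pd n f i) :=
  (contDiffOn_univ.1 (contDiffOn_pd isOpen_univ hf.contDiffOn i)).continuous

lemma contDiff_pd (hf : ContDiff ℝ (⊤ : ℕ∞) f) (i : Fin (n + 1)) :
    ContDiff ℝ (⊤ : ℕ∞) (pd n f i) :=
  contDiffOn_univ.1 (contDiffOn_pd isOpen_univ hf.contDiffOn i)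

lemma pd_eq_fderivWithin_closure {Ω : Set (Euc n)} (hΩ : IsOpen Ω) {g : Euc n → ℝ} {x : Euc n}
    (hx : x ∈ Ω) (i : Fin (n + 1)) :
    pd n g i x = fderivWithin ℝ g (closure Ω) x (EuclideanSpace.single i 1) := by
  rw [pd, fderivWithin_of_mem_nhds (mem_of_superset (hΩ.mem_nhds hx) subset_closure)]

lemma contDiffOn_fderivWithin_closure {Ω : Set (Euc n)} (hU : UniqueDiffOn ℝ (closure Ω))
    {g : Euc n → ℝ} (hg : ContDiffOn ℝ (⊤ : ℕ∞) g (closure Ω)) (i : Fin (n + 1)) :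
    ContDiffOn ℝ (⊤ : ℕ∞)
      (fun x => fderivWithin ℝ g (closure Ω) x (EuclideanSpace.single i 1)) (closure Ω) :=
  (hg.fderivWithin hU (by simp)).clm_apply contDiffOn_const

lemma boundary_term_bound (hf : ContDiff ℝ (⊤ : ℕ∞) f)
    {x : Euc n} (hx : x ∈ frontier {x | f x < 0}) (hx' : fderiv ℝ f x ≠ 0)
    {X : Fin (n + 1) → Euc n → ℝ}
    (hX : ∀ j, DifferentiableWithinAt ℝ (X j) (closure {x | f x < 0}) x)
    (hX1 : ∑ j, X j x ^ 2 ≤ 1)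
    (hXf : ∀ y ∈ frontier {x | f x < 0}, ∀ j l, X j y * pd n f l y = X l y * pd n f j y)
    (V : Fin (n + 1) → Fin (n + 1) → ℝ)
    (hV : ∀ i j, V i j =
      fderivWithin ℝ (X j) (closure {x | f x < 0}) x (EuclideanSpace.single i 1)) :
    gradSq n f x * |∑ i, ∑ j, X i x * (pd n f i x * V j j - pd n f j x * V i j)| ≤
      (∑ l, |pd n f l x|) *
        ∑ i, ∑ j, |pd n f i x * pd2 n f j j x - pd n f j x * pd2 n f i j x| := by
  have hid := boundary_term_identity (fun i => X i x) (fun i => pd n f i x) V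
    (fun i j => pd2 n f i j x) (fun i j => hXf x hx i j) (fun i j l => by
      have hd : ∀ a b, HasFDerivWithinAt (fun y => X a y * pd n f b y)
          (X a x • fderiv ℝ (pd n f b) x +
            pd n f b x • fderivWithin ℝ (X a) (closure {x | f x < 0}) x)
          (closure {x | f x < 0}) x := fun a b =>
        (hX a).hasFDerivWithinAt.mul
          ((contDiff_pd hf b).differentiable (by simp) x).hasFDerivAt.hasFDerivWithinAt
      have ht := tangential_derivative_eq_zero hf hx hx' ((hd j l).sub (hd l j))
        (fun y hy => sub_eq_zero.2 (hXf y hy j l)) i j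
      simp only [sub_apply, add_apply,
        smul_apply, smul_eq_mul, ← hV] at ht
      simp only [pd2]
      unfold pd at ht ⊢
      linear_combination ht)
  have h1 : ∀ i, |X i x| ≤ 1 := fun i => by
    rw [← sq_le_one_iff_abs_le_one]
    exact (Finset.single_le_sum (f := fun j => X j x ^ 2) (fun j _ => sq_nonneg _)
      (Finset.mem_univ i)).trans hX1
  have hb := abs_boundary_term_le (fun i => X i x) (fun i => pd n f i x)
    (fun i j => pd2 n f i j x) h1
  rw [← hid, abs_mul, abs_of_nonneg (Finset.sum_nonneg fun i _ => sq_nonneg _)] at hb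
  exact hb

lemma integral_cutoffDensity_le (hf : ContDiff ℝ (⊤ : ℕ∞) f) (hb : IsBounded {x | f x < 0})
    {L : ℝ} (hL : ∀ x, f x < 0 → ∑ i, pd2 n f i i x ≤ L) (hL0 : 0 ≤ L) {δ : ℝ} (hδ : 0 < δ) :
    ∫ x, cutoffDensity f δ x * gradSq n f x ≤ L * volume.real {x | f x < 0} := by
  have ho : IsOpen {x | f x < 0} := isOpen_lt hf.continuous continuous_const
  have hz : ∀ x, -δ < f x → cutoff f δ x = 0 := fun x hx => cutoff_eq_zero hδ hx
  have hz' : ∀ x, -δ < f x → cutoffDensity f δ x = 0 :=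
    fun x hx => cutoffDensity_eq_zero_of_lt hδ hx
  have hc := hasCompactSupport_of_eq_zero hf.continuous hb hδ hz
  have hc' := hasCompactSupport_of_eq_zero hf.continuous hb hδ hz'
  have hcη := (contDiff_cutoff (δ := δ) hf).continuous
  have hcγ := continuous_cutoffDensity (δ := δ) hf.continuous
  have e : ∫ x, cutoffDensity f δ x * gradSq n f x =
      ∫ x, cutoff f δ x * ∑ i, pd2 n f i i x := by
    simp only [gradSq, Finset.mul_sum]
    rw [integral_finsetSum, integral_finsetSum]
    · refine Finset.sum_congr rfl fun i _ => ?_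
      have := integral_mul_pd isOpen_univ (contDiff_cutoff (δ := δ) hf) hc (Set.subset_univ _)
        (contDiff_pd hf i).contDiffOn i
      simp only [pd2]
      rw [this, ← integral_neg]
      congr 1 with x
      rw [pd_cutoff hf]
      ring
    · exact fun i _ => integrable_mul_of_tsupport_subset isOpen_univ hcη hc (Set.subset_univ _)
        (continuous_pd (contDiff_pd hf i) i).continuousOn
    · exact fun i _ => integrable_mul_of_tsupport_subset isOpen_univ hcγ hc' (Set.subset_univ _)
        ((continuous_pd hf i).pow 2).continuousOn
  rw [e, ← setIntegral_eq_integral_of_forall_compl_eq_zero (s := {x | f x < 0})]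
  · calc ∫ x in {x | f x < 0}, cutoff f δ x * ∑ i, pd2 n f i i x
        ≤ ∫ _ in {x | f x < 0}, L := by
          refine setIntegral_mono_on ?_ ?_ ho.measurableSet fun x hx => ?_
          · exact (integrable_mul_of_tsupport_subset isOpen_univ hcη hc (Set.subset_univ _)
              (continuous_finsetSum _ fun i _ =>
                continuous_pd (contDiff_pd hf i) i).continuousOn).integrableOn
          · exact integrableOn_const hb.measure_lt_top.ne
          · have h0 := cutoff_nonneg (f := f) (δ := δ) x
            have h1 := cutoff_le_one (f := f) (δ := δ) x
            have := hL x hx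
            nlinarith [mul_le_mul_of_nonneg_left this h0]
      _ = L * volume.real {x | f x < 0} := by
          rw [setIntegral_const, smul_eq_mul, mul_comm]
  · intro x hx
    have hx : ¬ f x < 0 := hx
    rw [hz x (by linarith), zero_mul]

end BoundaryTerm

section DivergenceIdentity

variable {n : ℕ} {f : Euc n → ℝ}

lemma integrableOn_of_continuousOn_closure {Ω : Set (Euc n)} (hb : IsBounded Ω)
    {g h : Euc n → ℝ} (hΩ : IsOpen Ω) (hh : ContinuousOn h (closure Ω)) (hgh : Set.EqOn g h Ω) :
    IntegrableOn g Ω :=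
  ((hh.integrableOn_compact hb.isCompact_closure).mono_set subset_closure).congr_fun
    hgh.symm hΩ.measurableSet

lemma integral_cutoff_mul_jacobian (hf : ContDiff ℝ (⊤ : ℕ∞) f) (hb : IsBounded {x | f x < 0})
    {δ : ℝ} (hδ : 0 < δ) {X : Fin (n + 1) → Euc n → ℝ}
    (hX : ∀ j, ContDiffOn ℝ (⊤ : ℕ∞) (X j) {x | f x < 0}) :
    ∫ x, cutoff f δ x * ((∑ i, pd n (X i) i x) ^ 2 - ∑ i, ∑ j, pd n (X i) j x * pd n (X j) i x) =
      ∫ x, cutoffDensity f δ x * ∑ i, ∑ j, X i x *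
        (pd n f i x * pd n (X j) j x - pd n f j x * pd n (X j) i x) := by
  have ho : IsOpen {x | f x < 0} := isOpen_lt hf.continuous continuous_const
  have hz : ∀ x, -δ < f x → cutoff f δ x = 0 := fun x hx => cutoff_eq_zero hδ hx
  have hz' : ∀ x, -δ < f x → cutoffDensity f δ x = 0 :=
    fun x hx => cutoffDensity_eq_zero_of_lt hδ hx
  have hsub : {x | f x ≤ -δ} ⊆ {x | f x < 0} := fun x (hx : f x ≤ -δ) =>
    show f x < 0 by linarith
  have hs := (tsupport_subset_of_eq_zero hf.continuous hz).trans hsub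
  have hs' := (tsupport_subset_of_eq_zero hf.continuous hz').trans hsub
  have hc := hasCompactSupport_of_eq_zero hf.continuous hb hδ hz
  have hc' := hasCompactSupport_of_eq_zero hf.continuous hb hδ hz'
  have hη := contDiff_cutoff (δ := δ) hf
  have hcγ := continuous_cutoffDensity (δ := δ) hf.continuous
  have hXc : ∀ j, ContinuousOn (X j) {x | f x < 0} := fun j => (hX j).continuousOn
  have hDX : ∀ i j, ContinuousOn (pd n (X j) i) {x | f x < 0} := fun i j =>
    (contDiffOn_pd ho (hX j) i).continuousOn
  have hDf : ∀ i, ContinuousOn (pd n f i) {x | f x < 0} := fun i =>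
    (continuous_pd hf i).continuousOn
  have e1 : ∀ x, cutoff f δ x *
      ((∑ i, pd n (X i) i x) ^ 2 - ∑ i, ∑ j, pd n (X i) j x * pd n (X j) i x) =
      ∑ i, ∑ j, cutoff f δ x *
        (pd n (X i) i x * pd n (X j) j x - pd n (X i) j x * pd n (X j) i x) := by
    intro x
    simp_rw [sq, Finset.sum_mul_sum, ← Finset.sum_sub_distrib, Finset.mul_sum]
  have e2 : ∀ x, cutoffDensity f δ x * ∑ i, ∑ j, X i x *
        (pd n f i x * pd n (X j) j x - pd n f j x * pd n (X j) i x) =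
      ∑ i, ∑ j, cutoffDensity f δ x * (X i x *
        (pd n f i x * pd n (X j) j x - pd n f j x * pd n (X j) i x)) := by
    intro x
    simp_rw [Finset.mul_sum]
  have i1 : ∀ i j, Integrable fun x => cutoff f δ x *
        (pd n (X i) i x * pd n (X j) j x - pd n (X i) j x * pd n (X j) i x) := fun i j =>
    integrable_mul_of_tsupport_subset ho hη.continuous hc hs
      (((hDX i i).mul (hDX j j)).sub ((hDX j i).mul (hDX i j)))
  have i2 : ∀ i j, Integrable fun x => cutoffDensity f δ x * (X i x *
        (pd n f i x * pd n (X j) j x - pd n f j x * pd n (X j) i x)) := fun i j =>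
    integrable_mul_of_tsupport_subset ho hcγ hc' hs'
      ((hXc i).mul (((hDf i).mul (hDX j j)).sub ((hDf j).mul (hDX i j))))
  simp_rw [e1, e2]
  rw [integral_finsetSum _ fun i _ => integrable_finsetSum _ fun j _ => i1 i j,
    integral_finsetSum _ fun i _ => integrable_finsetSum _ fun j _ => i2 i j]
  refine Finset.sum_congr rfl fun i _ => ?_
  rw [integral_finsetSum _ fun j _ => i1 i j, integral_finsetSum _ fun j _ => i2 i j]
  refine Finset.sum_congr rfl fun j _ => ?_
  rw [integral_mul_jacobian ho hη hc hs (hX i) (hX j)]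
  congr 1 with x
  rw [pd_cutoff hf, pd_cutoff hf]
  ring

/-- For a vector field `X` with `|X| ≤ 1` which is normal to the boundary,
`∫ tr((DX)²) ≤ ∫ (div X)² + C` with `C` depending only on the domain. -/
lemma exists_integral_trace_sq_le (hf : ContDiff ℝ (⊤ : ℕ∞) f) (hb : IsBounded {x | f x < 0})
    (hf' : ∀ x ∈ frontier {x | f x < 0}, fderiv ℝ f x ≠ 0) :
    ∃ C : ℝ, 0 ≤ C ∧ ∀ X : Fin (n + 1) → Euc n → ℝ,
      (∀ j, ContDiffOn ℝ (⊤ : ℕ∞) (X j) (closure {x | f x < 0})) →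
      (∀ x ∈ closure {x | f x < 0}, ∑ j, X j x ^ 2 ≤ 1) →
      (∀ y ∈ frontier {x | f x < 0}, ∀ j l, X j y * pd n f l y = X l y * pd n f j y) →
      ∫ x in {x | f x < 0}, ∑ i, ∑ j, pd n (X i) j x * pd n (X j) i x ≤
        (∫ x in {x | f x < 0}, (∑ i, pd n (X i) i x) ^ 2) + C := by
  have ho : IsOpen {x | f x < 0} := isOpen_lt hf.continuous continuous_const
  have hU := uniqueDiffOn_closure_sublevel hf hf'
  set Ω : Set (Euc n) := {x | f x < 0} with hΩ
  have hK : IsCompact (closure Ω) := hb.isCompact_closure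
  have hKf : IsCompact (frontier Ω) := hK.of_isClosed_subset isClosed_frontier
    frontier_subset_closure
  have hcp : ∀ i, Continuous (pd n f i) := continuous_pd hf
  have hcp2 : ∀ i j, Continuous (pd2 n f i j) := fun i j => continuous_pd (contDiff_pd hf j) i
  have hcg : Continuous (gradSq n f) := by unfold gradSq; fun_prop
  obtain ⟨m, hm, hmf⟩ := hKf.exists_forall_le' (f := gradSq n f) (a := 0) hcg.continuousOn
    (fun x hx => gradSq_pos (hf' x hx))
  obtain ⟨E, hE⟩ := hK.exists_bound_of_continuousOn (f := fun x => (∑ l, |pd n f l x|) *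
        ∑ i, ∑ j, |pd n f i x * pd2 n f j j x - pd n f j x * pd2 n f i j x|)
        (Continuous.continuousOn (by fun_prop))
  obtain ⟨L, hL⟩ := hK.exists_bound_of_continuousOn (f := fun x => ∑ i, pd2 n f i i x)
        (Continuous.continuousOn (by fun_prop))
  set B : ℝ := |E| / m + 1 with hB
  have hB0 : 0 < B := by positivity
  refine ⟨B / (m / 2) * (|L| * volume.real Ω), by positivity, fun X hX hX1 hXf => ?_⟩
  have hXΩ : ∀ j, ContDiffOn ℝ (⊤ : ℕ∞) (X j) Ω := fun j => (hX j).mono subset_closure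
  let V : Fin (n + 1) → Fin (n + 1) → Euc n → ℝ := fun i j x =>
    fderivWithin ℝ (X j) (closure Ω) x (EuclideanSpace.single i 1)
  have hVc : ∀ i j, ContinuousOn (V i j) (closure Ω) := fun i j =>
    (contDiffOn_fderivWithin_closure hU (hX j) i).continuousOn
  have hVΩ : ∀ i j, ∀ x ∈ Ω, pd n (X j) i x = V i j x := fun i j x hx =>
    pd_eq_fderivWithin_closure ho hx i
  have hXc : ∀ j, ContinuousOn (X j) (closure Ω) := fun j => (hX j).continuousOn
  let Q : Euc n → ℝ := fun x =>
    ∑ i, ∑ j, X i x * (pd n f i x * V j j x - pd n f j x * V i j x)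
  have hQc : ContinuousOn (fun x => |Q x|) (closure Ω) :=
    (continuousOn_finsetSum _ fun i _ => continuousOn_finsetSum _ fun j _ =>
      (hXc i).mul (((hcp i).continuousOn.mul (hVc j j)).sub
        ((hcp j).continuousOn.mul (hVc i j)))).abs
  have hQB : ∀ x ∈ frontier Ω, |Q x| < B := fun x hx => by
    have hxK : x ∈ closure Ω := frontier_subset_closure hx
    have h1 := boundary_term_bound hf hx (hf' x hx)
      (fun j => (hX j).differentiableOn (by simp) x hxK) (hX1 x hxK) hXf (fun i j => V i j x)
      (fun i j => rfl)
    have h2 : gradSq n f x * |Q x| ≤ |E| :=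
      h1.trans ((le_abs_self _).trans ((hE x hxK).trans (le_abs_self E)))
    have h3 : m * |Q x| ≤ |E| :=
      (mul_le_mul_of_nonneg_right (hmf x hx) (abs_nonneg _)).trans h2
    have h4 : |Q x| ≤ |E| / m := by rw [le_div_iff₀ hm]; linarith
    rw [hB]; linarith
  obtain ⟨δ₁, hδ₁, hl₁⟩ := exists_boundary_layer hf.continuous hb hQc hQB
  obtain ⟨δ₂, hδ₂, hl₂⟩ := exists_boundary_layer hf.continuous hb (φ := fun x => -gradSq n f x)
    (A := -(m / 2)) hcg.neg.continuousOn (fun x hx => by have := hmf x hx; linarith)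
  let G : Euc n → ℝ := fun x =>
    (∑ i, pd n (X i) i x) ^ 2 - ∑ i, ∑ j, pd n (X i) j x * pd n (X j) i x
  have hI1 : IntegrableOn (fun x => (∑ i, pd n (X i) i x) ^ 2) Ω :=
    integrableOn_of_continuousOn_closure hb ho
      (h := fun x => (∑ i, V i i x) ^ 2) ((continuousOn_finsetSum _ fun i _ => hVc i i).pow 2)
      (fun x hx => by simp only [fun i j => hVΩ i j x hx])
  have hI2 : IntegrableOn (fun x => ∑ i, ∑ j, pd n (X i) j x * pd n (X j) i x) Ω :=
    integrableOn_of_continuousOn_closure hb ho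
      (h := fun x => ∑ i, ∑ j, V j i x * V i j x)
      (continuousOn_finsetSum _ fun i _ => continuousOn_finsetSum _ fun j _ =>
        (hVc j i).mul (hVc i j))
      (fun x hx => by simp only [fun i j => hVΩ i j x hx])
  have hIG : IntegrableOn G Ω := hI1.sub hI2
  have hδ : ∀ δ, 0 < δ → 2 * δ < δ₁ → 2 * δ < δ₂ →
      -(B / (m / 2) * (|L| * volume.real Ω)) ≤ ∫ x in Ω, cutoff f δ x * G x := by
    intro δ hδ h1 h2
    have hz' : ∀ x, -δ < f x → cutoffDensity f δ x = 0 :=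
      fun x hx => cutoffDensity_eq_zero_of_lt hδ hx
    have hsub : {x | f x ≤ -δ} ⊆ Ω := fun x (hx : f x ≤ -δ) => show f x < 0 by linarith
    have hs' := (tsupport_subset_of_eq_zero hf.continuous hz').trans hsub
    have hc' := hasCompactSupport_of_eq_zero hf.continuous hb hδ hz'
    have hcγ := continuous_cutoffDensity (δ := δ) hf.continuous
    rw [setIntegral_eq_integral_of_forall_compl_eq_zero (fun x hx => by
      have hx : ¬ f x < 0 := hx
      rw [cutoff_eq_zero hδ (by linarith), zero_mul]),
      integral_cutoff_mul_jacobian hf hb hδ hXΩ]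
    have hle := integral_cutoffDensity_le hf hb (L := |L|)
      (fun x hx => (le_abs_self _).trans ((hL x (subset_closure hx)).trans (le_abs_self L)))
      (abs_nonneg L) hδ
    calc -(B / (m / 2) * (|L| * volume.real Ω))
        ≤ -(B / (m / 2) * ∫ x, cutoffDensity f δ x * gradSq n f x) :=
          neg_le_neg (mul_le_mul_of_nonneg_left hle (by positivity))
      _ = ∫ x, -(B / (m / 2) * (cutoffDensity f δ x * gradSq n f x)) := by
          rw [integral_neg, integral_const_mul]
      _ ≤ _ := by
          refine integral_mono ?_ ?_ fun x => ?_
          · exact ((integrable_mul_of_tsupport_subset ho hcγ hc' hs'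
              hcg.continuousOn).const_mul _).neg
          · refine integrable_mul_of_tsupport_subset ho hcγ hc' hs' ?_
            exact continuousOn_finsetSum _ fun i _ => continuousOn_finsetSum _ fun j _ =>
              (hXΩ i).continuousOn.mul
                (((hcp i).continuousOn.mul (contDiffOn_pd ho (hXΩ j) j).continuousOn).sub
                  ((hcp j).continuousOn.mul (contDiffOn_pd ho (hXΩ j) i).continuousOn))
          · by_cases hx1 : -δ < f x
            · simp [hz' x hx1]
            by_cases hx2 : f x < -(2 * δ)
            · simp [cutoffDensity_eq_zero_of_lt_neg hδ hx2]
            have hxΩ : x ∈ Ω := show f x < 0 by linarith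
            have hq := hl₁ x hxΩ (by linarith)
            have hg := hl₂ x hxΩ (by linarith)
            have hγ := cutoffDensity_nonneg (f := f) hδ x
            simp only [fun i j => hVΩ i j x hxΩ]
            have hBg : B ≤ B / (m / 2) * gradSq n f x := by
              rw [div_mul_eq_mul_div, le_div_iff₀ (by positivity)]
              exact mul_le_mul_of_nonneg_left (by linarith) hB0.le
            have hQ : -(B / (m / 2) * gradSq n f x) ≤ Q x := by
              have := neg_abs_le (Q x)
              linarith
            have := mul_le_mul_of_nonneg_left hQ hγ
            calc _ = cutoffDensity f δ x * -(B / (m / 2) * gradSq n f x) := by ring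
              _ ≤ _ := this
  have hlim : Tendsto (fun δ => ∫ x in Ω, cutoff f δ x * G x) (𝓝[>] 0) (𝓝 (∫ x in Ω, G x)) := by
    refine tendsto_integral_filter_of_dominated_convergence (fun x => |G x|) ?_ ?_ hIG.abs ?_
    · exact Eventually.of_forall fun δ =>
        (contDiff_cutoff hf).continuous.aestronglyMeasurable.mul hIG.aestronglyMeasurable
    · refine Eventually.of_forall fun δ => Eventually.of_forall fun x => ?_
      rw [Real.norm_eq_abs, abs_mul, abs_of_nonneg (cutoff_nonneg x)]
      exact mul_le_of_le_one_left (abs_nonneg _) (cutoff_le_one x)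
    · refine (ae_restrict_iff' ho.measurableSet).2 (Eventually.of_forall fun x hx => ?_)
      simpa using (tendsto_cutoff hx).mul_const (G x)
  have hfin : -(B / (m / 2) * (|L| * volume.real Ω)) ≤ ∫ x in Ω, G x := by
    refine ge_of_tendsto hlim ?_
    have h1 : ∀ᶠ δ : ℝ in 𝓝[>] 0, δ < δ₁ / 2 := nhdsWithin_le_nhds (gt_mem_nhds (by linarith))
    have h2 : ∀ᶠ δ : ℝ in 𝓝[>] 0, δ < δ₂ / 2 := nhdsWithin_le_nhds (gt_mem_nhds (by linarith))
    filter_upwards [h1, h2, self_mem_nhdsWithin] with δ h1 h2 h3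
    exact hδ δ h3 (by linarith) (by linarith)
  have hsub : ∫ x in Ω, G x = (∫ x in Ω, (∑ i, pd n (X i) i x) ^ 2) -
      ∫ x in Ω, ∑ i, ∑ j, pd n (X i) j x * pd n (X j) i x := integral_sub hI1 hI2
  linarith

end DivergenceIdentity

section TraceInequality

variable {ι : Type*} [Fintype ι]

lemma sum_sq_rank_two_perturbation (M : ι → ι → ℝ) (p q : ι → ℝ) (hM : ∀ i j, M i j = M j i)
    (hq : ∀ i, q i = ∑ l, M i l * p l) (a b d : ℝ) :
    ∑ i, ∑ j, (a * M i j + b * (p i * q j + q i * p j) + d * (p i * p j)) ^ 2 =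
      a ^ 2 * ∑ i, ∑ j, M i j ^ 2 + 4 * a * b * ∑ i, q i ^ 2 +
        2 * b ^ 2 * ((∑ i, p i ^ 2) * ∑ i, q i ^ 2 + (∑ i, p i * q i) ^ 2) +
        2 * a * d * ∑ i, p i * q i + 4 * b * d * ((∑ i, p i ^ 2) * ∑ i, p i * q i) +
        d ^ 2 * (∑ i, p i ^ 2) ^ 2 := by
  have h1 : ∑ i, q i * ∑ j, M i j * p j = ∑ i, q i ^ 2 :=
    Finset.sum_congr rfl fun i _ => by rw [← hq, sq]
  have h2 : ∑ i, ∑ j, q j * (M j i * p i) = ∑ i, q i ^ 2 := by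
    rw [Finset.sum_comm, ← h1]
    simp_rw [Finset.mul_sum]
  have h3 : ∑ i, p i * ∑ j, M i j * p j = ∑ i, p i * q i :=
    Finset.sum_congr rfl fun i _ => by rw [← hq]
  have e : ∀ i j, (a * M i j + b * (p i * q j + q i * p j) + d * (p i * p j)) ^ 2 =
      a ^ 2 * M i j ^ 2 + 2 * a * b * (q i * (M i j * p j)) + 2 * a * b * (q j * (M j i * p i)) +
      2 * a * d * (p i * (M i j * p j)) + b ^ 2 * (p i ^ 2 * q j ^ 2) + b ^ 2 * (q i ^ 2 * p j ^ 2)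
      + 2 * b ^ 2 * ((p i * q i) * (p j * q j)) + 2 * b * d * (p i ^ 2 * (p j * q j)) +
      2 * b * d * ((p i * q i) * p j ^ 2) + d ^ 2 * (p i ^ 2 * p j ^ 2) := by
    intro i j
    rw [hM j i]
    ring
  simp_rw [e, Finset.sum_add_distrib, ← Finset.mul_sum, h1, h2, h3,
    ← Finset.sum_mul]
  ring

lemma sum_trace_sq_eq (M : ι → ι → ℝ) (p q : ι → ℝ) (hM : ∀ i j, M i j = M j i)
    (hq : ∀ i, q i = ∑ l, M i l * p l) (w : ℝ) :
    ∑ i, ∑ j, (M j i - p i * q j / w) * (M i j - p j * q i / w) =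
      ∑ i, ∑ j, M i j ^ 2 - 2 * (∑ i, q i ^ 2) / w + (∑ i, p i * q i) ^ 2 / w ^ 2 := by
  have h1 : ∑ i, q i * ∑ j, M i j * p j = ∑ i, q i ^ 2 :=
    Finset.sum_congr rfl fun i _ => by rw [← hq, sq]
  have h2 : ∑ i, ∑ j, q j * (M j i * p i) = ∑ i, q i ^ 2 := by
    rw [Finset.sum_comm, ← h1]
    simp_rw [Finset.mul_sum]
  have e : ∀ i j, (M j i - p i * q j / w) * (M i j - p j * q i / w) =
      M i j ^ 2 + (-w⁻¹) * (q i * (M i j * p j)) + (-w⁻¹) * (q j * (M j i * p i)) +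
      w⁻¹ ^ 2 * ((p i * q i) * (p j * q j)) := by
    intro i j
    rw [hM j i]
    ring
  simp_rw [e, Finset.sum_add_distrib, ← Finset.mul_sum, h1, h2,
    ← Finset.sum_mul]
  ring

/-- `tr(aMaM) ≥ λ² |M|²` for `a = I - p ⊗ p / w`, whose least eigenvalue is `λ = 1 - |p|² / w`. -/
lemma trace_sq_lower_bound (M : ι → ι → ℝ) (p q : ι → ℝ) (hM : ∀ i j, M i j = M j i)
    (hq : ∀ i, q i = ∑ l, M i l * p l) {w : ℝ} (hw : 0 < w) (hpw : ∑ i, p i ^ 2 ≤ w) :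
    ((w - ∑ i, p i ^ 2) / w) ^ 2 * ∑ i, ∑ j, M i j ^ 2 ≤
      ∑ i, ∑ j, (M j i - p i * q j / w) * (M i j - p j * q i / w) := by
  rw [sum_trace_sq_eq M p q hM hq w]
  have hsos := sum_sq_rank_two_perturbation M p q hM hq ((∑ i, p i ^ 2) ^ 2)
    (-∑ i, p i ^ 2) (∑ i, p i * q i)
  have hnn : 0 ≤ ∑ i, ∑ j, ((∑ i, p i ^ 2) ^ 2 * M i j + (-∑ i, p i ^ 2) *
      (p i * q j + q i * p j) + (∑ i, p i * q i) * (p i * p j)) ^ 2 :=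
    Finset.sum_nonneg fun i _ => Finset.sum_nonneg fun j _ => sq_nonneg _
  rw [hsos] at hnn
  have hcs := Finset.sum_mul_sq_le_sq_mul_sq Finset.univ p q
  have hP0 : 0 ≤ ∑ i, p i ^ 2 := Finset.sum_nonneg fun i _ => sq_nonneg _
  have hpz : ∑ i, p i ^ 2 = 0 → ∀ i, p i = 0 := fun h i => by
    have := (Finset.sum_eq_zero_iff_of_nonneg (fun i _ => sq_nonneg (p i))).1 h i
      (Finset.mem_univ i)
    exact pow_eq_zero_iff two_ne_zero |>.1 this
  have hqz : ∑ i, p i ^ 2 = 0 → ∑ i, q i ^ 2 = 0 := fun h => by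
    refine Finset.sum_eq_zero fun i _ => ?_
    rw [hq i]
    simp [hpz h]
  generalize ∑ i, ∑ j, M i j ^ 2 = A at *
  generalize ∑ i, p i ^ 2 = P at *
  generalize ∑ i, q i ^ 2 = R at *
  generalize ∑ i, p i * q i = c at *
  suffices h : 0 ≤ (2 * w * P - P ^ 2) * A - 2 * w * R + c ^ 2 by
    have e : A - 2 * R / w + c ^ 2 / w ^ 2 - ((w - P) / w) ^ 2 * A =
        ((2 * w * P - P ^ 2) * A - 2 * w * R + c ^ 2) / w ^ 2 := by
      field_simp
      ring
    rw [← sub_nonneg, e]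
    positivity
  rcases hP0.eq_or_lt with hP | hP
  · have hR := hqz hP.symm
    subst hP
    subst hR
    nlinarith [sq_nonneg c]
  · have h1 : 0 ≤ P ^ 2 * A - 2 * P * R + c ^ 2 := by
      have : 0 ≤ P ^ 2 * (P ^ 2 * A - 2 * P * R + c ^ 2) := by linarith
      exact nonneg_of_mul_nonneg_right this (by positivity)
    have h2 : 0 ≤ P * ((2 * w * P - P ^ 2) * A - 2 * w * R + c ^ 2) := by
      have h3 := mul_nonneg (show 0 ≤ 2 * w - P by linarith) h1
      have h4 := mul_nonneg (show 0 ≤ 2 * w - 2 * P by linarith) (sub_nonneg.2 hcs)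
      linarith
    exact nonneg_of_mul_nonneg_right h2 hP

end TraceInequality

section RegularizedEquation

variable {n : ℕ} {Ω : Set (Euc n)} {u : Euc n → ℝ} {ε : ℝ}

lemma pd_div_sqrt (hΩ : IsOpen Ω) (hu : ContDiffOn ℝ (⊤ : ℕ∞) u Ω) (hε : 0 < ε) {x : Euc n}
    (hx : x ∈ Ω) (i j : Fin (n + 1)) :
    pd n (fun y => pd n u i y / Real.sqrt (ε ^ 2 + gradSq n u y)) j x =
      (Real.sqrt (ε ^ 2 + gradSq n u x))⁻¹ * (pd2 n u j i x -
        pd n u i x * (∑ l, pd2 n u j l x * pd n u l x) / (ε ^ 2 + gradSq n u x)) := by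
  have hd : ∀ l, HasFDerivAt (pd n u l) (fderiv ℝ (pd n u l) x) x := fun l =>
    (differentiableAt_of_contDiffOn hΩ (contDiffOn_pd hΩ hu l) hx).hasFDerivAt
  have hw : 0 < ε ^ 2 + gradSq n u x :=
    add_pos_of_pos_of_nonneg (by positivity) (Finset.sum_nonneg fun i _ => sq_nonneg _)
  have hg : HasFDerivAt (fun y => ε ^ 2 + gradSq n u y)
      (∑ l, (2 * pd n u l x) • fderiv ℝ (pd n u l) x) x := by
    have := (HasFDerivAt.fun_sum (u := Finset.univ) fun l _ => (hd l).pow 2).const_add (ε ^ 2)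
    simpa [gradSq] using this
  have hs := hg.sqrt hw.ne'
  have hsq : 0 < Real.sqrt (ε ^ 2 + gradSq n u x) := Real.sqrt_pos.2 hw
  have h := (hd i).fun_mul ((hasDerivAt_inv hsq.ne').comp_hasFDerivAt x hs)
  simp only [div_eq_mul_inv (pd n u i _) (Real.sqrt _)]
  rw [pd]
  erw [h.fderiv]
  have hS : (∑ l, (2 * pd n u l x) • fderiv ℝ (pd n u l) x) (EuclideanSpace.single j 1) =
      2 * ∑ l, pd2 n u j l x * pd n u l x := by
    rw [sum_apply, Finset.mul_sum]
    refine Finset.sum_congr rfl fun l _ => ?_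
    simp only [smul_apply, smul_eq_mul, pd2]
    rw [pd.eq_def n (pd n u l)]
    ring
  simp only [smul_apply, add_apply, smul_eq_mul, hS, Function.comp_apply]
  have hsqr : Real.sqrt (ε ^ 2 + gradSq n u x) ^ 2 = ε ^ 2 + gradSq n u x := Real.sq_sqrt hw.le
  have hp : fderiv ℝ (pd n u i) x (EuclideanSpace.single j 1) = pd2 n u j i x := rfl
  rw [hp, ← hsqr, Real.sqrt_sq hsq.le]
  field_simp
  ring

lemma sum_pd2_sq_le (hΩ : IsOpen Ω) (hu : ContDiffOn ℝ (⊤ : ℕ∞) u Ω) (hε : 0 < ε) {x : Euc n}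
    (hx : x ∈ Ω) {W : ℝ} (hW : ε ^ 2 + gradSq n u x ≤ W) :
    ∑ i, ∑ j, pd2 n u i j x ^ 2 ≤ W ^ 3 / ε ^ 4 *
      ∑ i, ∑ j, pd n (fun y => pd n u i y / Real.sqrt (ε ^ 2 + gradSq n u y)) j x *
        pd n (fun y => pd n u j y / Real.sqrt (ε ^ 2 + gradSq n u y)) i x := by
  have hg0 : 0 ≤ gradSq n u x := Finset.sum_nonneg fun i _ => sq_nonneg _
  have hw : 0 < ε ^ 2 + gradSq n u x := by positivity
  have ht := trace_sq_lower_bound (fun i j => pd2 n u i j x) (fun i => pd n u i x)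
    (fun i => ∑ l, pd2 n u i l x * pd n u l x) (fun i j => pd2_comm hΩ hu hx i j) (fun i => rfl)
    hw (show gradSq n u x ≤ _ by nlinarith [sq_nonneg ε])
  have e : ∑ i, ∑ j, pd n (fun y => pd n u i y / Real.sqrt (ε ^ 2 + gradSq n u y)) j x *
        pd n (fun y => pd n u j y / Real.sqrt (ε ^ 2 + gradSq n u y)) i x =
      (ε ^ 2 + gradSq n u x)⁻¹ * ∑ i, ∑ j, (pd2 n u j i x - pd n u i x *
        (∑ l, pd2 n u j l x * pd n u l x) / (ε ^ 2 + gradSq n u x)) * (pd2 n u i j x -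
          pd n u j x * (∑ l, pd2 n u i l x * pd n u l x) / (ε ^ 2 + gradSq n u x)) := by
    simp_rw [pd_div_sqrt hΩ hu hε hx, Finset.mul_sum (Finset.univ : Finset (Fin (n + 1)))
      _ ((ε ^ 2 + gradSq n u x)⁻¹)]
    refine Finset.sum_congr rfl fun i _ => Finset.sum_congr rfl fun j _ => ?_
    have hsq : (Real.sqrt (ε ^ 2 + gradSq n u x))⁻¹ * (Real.sqrt (ε ^ 2 + gradSq n u x))⁻¹ =
        (ε ^ 2 + gradSq n u x)⁻¹ := by
      rw [← mul_inv, Real.mul_self_sqrt hw.le]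
    rw [← hsq]
    ring
  rw [e]
  have hgs : ∑ i, pd n u i x ^ 2 = gradSq n u x := rfl
  rw [hgs, add_sub_cancel_right] at ht
  have hA : 0 ≤ ∑ i, ∑ j, pd2 n u i j x ^ 2 :=
    Finset.sum_nonneg fun i _ => Finset.sum_nonneg fun j _ => sq_nonneg _
  set w := ε ^ 2 + gradSq n u x
  calc ∑ i, ∑ j, pd2 n u i j x ^ 2
      = w ^ 3 / ε ^ 4 * (w⁻¹ * ((ε ^ 2 / w) ^ 2 * ∑ i, ∑ j, pd2 n u i j x ^ 2)) := by
        field_simp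
    _ ≤ W ^ 3 / ε ^ 4 * (w⁻¹ * ((ε ^ 2 / w) ^ 2 * ∑ i, ∑ j, pd2 n u i j x ^ 2)) := by
        gcongr
    _ ≤ _ := by
        have hW0 : 0 < W := hw.trans_le hW
        gcongr

lemma sq_rpow_le (hε : 0 < ε) {g : ℝ} (hg : 0 ≤ g) {k : ℝ} (hk : 0 < k) :
    (-((ε ^ 2 + g) ^ (-(1 / (2 * k))))) ^ 2 ≤ (ε ^ (-(1 / k))) ^ 2 := by
  have hw : ε ^ 2 ≤ ε ^ 2 + g := by linarith
  have h1 : (ε ^ 2 + g) ^ (-(1 / (2 * k))) ≤ (ε ^ 2) ^ (-(1 / (2 * k))) :=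
    Real.rpow_le_rpow_of_nonpos (by positivity) hw (by rw [neg_nonpos]; positivity)
  have h2 : (ε ^ 2) ^ (-(1 / (2 * k))) = ε ^ (-(1 / k)) := by
    rw [← Real.rpow_natCast, ← Real.rpow_mul hε.le]
    congr 1
    push_cast
    field_simp
  rw [neg_sq, ← h2]
  have : 0 ≤ (ε ^ 2 + g) ^ (-(1 / (2 * k))) := by positivity
  gcongr

lemma exists_integral_hessian_sq_le {f : Euc n → ℝ} (hf : ContDiff ℝ (⊤ : ℕ∞) f)
    (hb : IsBounded {x | f x < 0}) (hf' : ∀ x ∈ frontier {x | f x < 0}, fderiv ℝ f x ≠ 0)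
    {k : ℝ} (hk : 0 < k) :
    ∃ C : ℝ, 0 ≤ C ∧ ∀ ε W : ℝ, 0 < ε → ∀ u : Euc n → ℝ,
      ContDiffOn ℝ (⊤ : ℕ∞) u (closure {x | f x < 0}) →
      SolvesReg n k ε {x | f x < 0} u →
      (∀ x ∈ frontier {x | f x < 0}, u x = 0) →
      (∀ x, f x < 0 → ε ^ 2 + gradSq n u x ≤ W) → 0 ≤ W →
      IntegrableOn (fun x => ∑ i, ∑ j, pd2 n u i j x ^ 2) {x | f x < 0} ∧
      ∫ x in {x | f x < 0}, ∑ i, ∑ j, pd2 n u i j x ^ 2 ≤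
        W ^ 3 / ε ^ 4 * (volume.real {x | f x < 0} * (ε ^ (-(1 / k))) ^ 2 + C) := by
  obtain ⟨C, hC, h⟩ := exists_integral_trace_sq_le hf hb hf'
  refine ⟨C, hC, fun ε W hε u hu hsol hu0 hW hW0 => ?_⟩
  have ho : IsOpen {x | f x < 0} := isOpen_lt hf.continuous continuous_const
  have hU := uniqueDiffOn_closure_sublevel hf hf'
  set Ω : Set (Euc n) := {x | f x < 0} with hΩ
  have huΩ : ContDiffOn ℝ (⊤ : ℕ∞) u Ω := hu.mono subset_closure
  let D : Fin (n + 1) → Euc n → ℝ := fun i x =>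
    fderivWithin ℝ u (closure Ω) x (EuclideanSpace.single i 1)
  have hD : ∀ i, ContDiffOn ℝ (⊤ : ℕ∞) (D i) (closure Ω) := fun i =>
    contDiffOn_fderivWithin_closure hU hu i
  have hDΩ : ∀ i, Set.EqOn (pd n u i) (D i) Ω := fun i x hx => pd_eq_fderivWithin_closure ho hx i
  let w : Euc n → ℝ := fun x => ε ^ 2 + ∑ i, D i x ^ 2
  have hw : ∀ x, 0 < w x := fun x =>
    add_pos_of_pos_of_nonneg (by positivity) (Finset.sum_nonneg fun i _ => sq_nonneg _)
  have hwc : ContDiffOn ℝ (⊤ : ℕ∞) w (closure Ω) :=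
    contDiffOn_const.add (ContDiffOn.sum fun i _ => (hD i).pow 2)
  let X : Fin (n + 1) → Euc n → ℝ := fun i x => D i x / Real.sqrt (w x)
  have hX : ∀ i, ContDiffOn ℝ (⊤ : ℕ∞) (X i) (closure Ω) := fun i =>
    (hD i).div (hwc.sqrt fun x _ => (hw x).ne') fun x _ => (Real.sqrt_pos.2 (hw x)).ne'
  have hXΩ : ∀ i, Set.EqOn (X i) (fun y => pd n u i y / Real.sqrt (ε ^ 2 + gradSq n u y)) Ω := by
    intro i x hx
    simp only [X, w, gradSq, fun i => hDΩ i hx]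
  have hpdX : ∀ i j, ∀ x ∈ Ω, pd n (X i) j x =
      pd n (fun y => pd n u i y / Real.sqrt (ε ^ 2 + gradSq n u y)) j x := fun i j x hx =>
    pd_eq_of_eqOn ho (hXΩ i) hx j
  have hX1 : ∀ x ∈ closure Ω, ∑ j, X j x ^ 2 ≤ 1 := fun x _ => by
    have : ∑ j, X j x ^ 2 = (∑ j, D j x ^ 2) / w x := by
      rw [Finset.sum_div]
      refine Finset.sum_congr rfl fun j _ => ?_
      simp only [X]
      rw [div_pow, Real.sq_sqrt (hw x).le]
    rw [this, div_le_one (hw x)]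
    simp only [w]
    nlinarith [sq_nonneg ε]
  have hXf : ∀ y ∈ frontier Ω, ∀ j l, X j y * pd n f l y = X l y * pd n f j y := by
    intro y hy j l
    have := tangential_derivative_eq_zero hf hy (hf' y hy)
      (hu.differentiableOn (by simp) y (frontier_subset_closure hy)).hasFDerivWithinAt hu0 l j
    simp only [X, D]
    rw [div_mul_eq_mul_div, div_mul_eq_mul_div, mul_comm _ (pd n f l y), this, mul_comm]
  have key := h X hX hX1 hXf
  have hVc : ∀ i j, ContinuousOn (fun x =>
      fderivWithin ℝ (X j) (closure Ω) x (EuclideanSpace.single i 1)) (closure Ω) := fun i j =>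
    (contDiffOn_fderivWithin_closure hU (hX j) i).continuousOn
  have hHc : ∀ i j, ContinuousOn (fun x =>
      fderivWithin ℝ (D j) (closure Ω) x (EuclideanSpace.single i 1)) (closure Ω) := fun i j =>
    (contDiffOn_fderivWithin_closure hU (hD j) i).continuousOn
  have hI : IntegrableOn (fun x => ∑ i, ∑ j, pd2 n u i j x ^ 2) Ω :=
    integrableOn_of_continuousOn_closure hb ho
      (continuousOn_finsetSum _ fun i _ => continuousOn_finsetSum _ fun j _ => (hHc i j).pow 2)
      (fun x hx => Finset.sum_congr rfl fun i _ => Finset.sum_congr rfl fun j _ => by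
        rw [pd2, pd_eq_of_eqOn ho (hDΩ j) hx i, pd_eq_fderivWithin_closure ho hx i]
        rfl)
  have hIX : IntegrableOn (fun x => ∑ i, ∑ j, pd n (X i) j x * pd n (X j) i x) Ω :=
    integrableOn_of_continuousOn_closure hb ho
      (continuousOn_finsetSum _ fun i _ => continuousOn_finsetSum _ fun j _ =>
        (hVc j i).mul (hVc i j))
      (fun x hx => Finset.sum_congr rfl fun i _ => Finset.sum_congr rfl fun j _ => by
        rw [pd_eq_fderivWithin_closure ho hx, pd_eq_fderivWithin_closure ho hx]
        rfl)
  have hID : IntegrableOn (fun x => (∑ i, pd n (X i) i x) ^ 2) Ω :=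
    integrableOn_of_continuousOn_closure hb ho
      ((continuousOn_finsetSum Finset.univ fun i _ => hVc i i).pow 2)
      (fun x hx => by
        simp only [fun i => pd_eq_fderivWithin_closure (g := X i) ho hx i]
        rfl)
  refine ⟨hI, ?_⟩
  have hdiv : ∫ x in Ω, (∑ i, pd n (X i) i x) ^ 2 ≤ volume.real Ω * (ε ^ (-(1 / k))) ^ 2 := by
    rw [← smul_eq_mul, ← setIntegral_const]
    refine setIntegral_mono_on hID (integrableOn_const hb.measure_lt_top.ne) ho.measurableSet
      fun x hx => ?_
    simp only [fun i => hpdX i i x hx]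
    rw [hsol x hx]
    exact sq_rpow_le hε (Finset.sum_nonneg fun i _ => sq_nonneg _) hk
  calc ∫ x in Ω, ∑ i, ∑ j, pd2 n u i j x ^ 2
      ≤ ∫ x in Ω, W ^ 3 / ε ^ 4 * ∑ i, ∑ j, pd n (X i) j x * pd n (X j) i x := by
        refine setIntegral_mono_on hI (hIX.const_mul _) ho.measurableSet fun x hx => ?_
        simp only [fun i j => hpdX i j x hx]
        exact sum_pd2_sq_le ho huΩ hε hx (hW x hx)
    _ = W ^ 3 / ε ^ 4 * ∫ x in Ω, ∑ i, ∑ j, pd n (X i) j x * pd n (X j) i x :=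
        integral_const_mul _ _
    _ ≤ _ := by
        refine mul_le_mul_of_nonneg_left ?_ (by positivity)
        linarith

end RegularizedEquation

/-- `H^{2,2}` estimate for the solutions of the regularized levelset equation: on a
bounded smooth domain, `‖u^ε‖_{H^{2,2}(Ω)} ≤ c ε^{−(4 + 1/k)}` for all sufficiently
small `ε > 0`, with `c = c(n, Ω, k, c₀)`. -/
theorem stmt10 (n : ℕ) (k c₀ : ℝ) (hk : 1 < k) (hc₀ : 0 < c₀)
    (Ω : Set (Euc n)) (hΩo : IsOpen Ω) (hΩb : IsBounded Ω) (hΩs : HasSmoothBoundary n Ω) :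
    ∃ c : ℝ, 0 < c ∧ ∃ ε₀ : ℝ, 0 < ε₀ ∧ ∀ ε : ℝ, 0 < ε → ε < ε₀ →
      ∀ u : Euc n → ℝ,
        ContDiffOn ℝ (⊤ : ℕ∞) u (closure Ω) →
        SolvesReg n k ε Ω u →
        (∀ x ∈ frontier Ω, u x = 0) →
        (∀ x ∈ closure Ω, |u x| ≤ c₀) →
        (∀ x ∈ Ω, Real.sqrt (gradSq n u x) ≤ c₀) →
        Real.sqrt (∫ x in Ω,
            ((u x) ^ 2 + gradSq n u x + ∑ i, ∑ j, (pd2 n u i j x) ^ 2)) ≤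
          c * ε ^ (-(4 + 1 / k)) := by
  obtain ⟨f, hf, rfl, hf'⟩ := hΩs
  obtain ⟨C, hC, h⟩ := exists_integral_hessian_sq_le hf hΩb hf' (k := k) (by linarith)
  set Ω : Set (Euc n) := {x | f x < 0} with hΩ
  let A : ℝ := 2 * c₀ ^ 2 * volume.real Ω + (1 + c₀ ^ 2) ^ 3 * (volume.real Ω + C) + 1
  have hA : 0 < A := by positivity
  refine ⟨Real.sqrt A, Real.sqrt_pos.2 hA, 1, one_pos, fun ε hε hε1 u hu hsol hu0 huc hDu => ?_⟩
  have hg0 : ∀ x, 0 ≤ gradSq n u x := fun x => Finset.sum_nonneg fun i _ => sq_nonneg _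
  have hg : ∀ x ∈ Ω, gradSq n u x ≤ c₀ ^ 2 := fun x hx => by
    have := (Real.sqrt_le_left hc₀.le).1 (hDu x hx)
    exact this
  obtain ⟨hI, hle⟩ := h ε (1 + c₀ ^ 2) hε u hu hsol hu0
    (fun x hx => add_le_add (by nlinarith) (hg x hx)) (by positivity)
  set r : ℝ := ε ^ (-(1 / k)) with hr
  have hr1 : 1 ≤ r ^ 2 := by
    refine one_le_pow₀ (Real.one_le_rpow_of_pos_of_le_one_of_nonpos hε hε1.le ?_)
    rw [neg_nonpos]
    have : 0 < k := by linarith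
    positivity
  have hpow : (ε ^ (-(4 + 1 / k))) ^ 2 = r ^ 2 / ε ^ 8 := by
    have : ε ^ (-(4 + 1 / k)) = r / ε ^ 4 := by
      rw [neg_add, Real.rpow_add hε, ← hr, Real.rpow_neg hε.le]
      norm_cast
      rw [mul_comm, div_eq_mul_inv]
    rw [this, div_pow]
    ring
  have h4 : 1 ≤ (ε ^ 4)⁻¹ := (one_le_inv₀ (by positivity)).2 (pow_le_one₀ hε.le hε1.le)
  have hV : 0 ≤ volume.real Ω := measureReal_nonneg
  have hbound : ∫ x in Ω, ((u x) ^ 2 + gradSq n u x + ∑ i, ∑ j, (pd2 n u i j x) ^ 2) ≤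
      A * (ε ^ (-(4 + 1 / k))) ^ 2 := by
    have h1 : ∫ x in Ω, ((u x) ^ 2 + gradSq n u x + ∑ i, ∑ j, (pd2 n u i j x) ^ 2) ≤
        ∫ x in Ω, (2 * c₀ ^ 2 + ∑ i, ∑ j, (pd2 n u i j x) ^ 2) := by
      refine integral_mono_of_nonneg (Eventually.of_forall fun x => ?_)
        ((integrableOn_const hΩb.measure_lt_top.ne).add hI) ?_
      · have := hg0 x
        exact add_nonneg (add_nonneg (sq_nonneg _) this)
          (Finset.sum_nonneg fun i _ => Finset.sum_nonneg fun j _ => sq_nonneg _)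
      · refine (ae_restrict_iff' hΩo.measurableSet).2 (Eventually.of_forall fun x hx => ?_)
        have h1 := sq_le_sq' (abs_le.1 (huc x (subset_closure hx))).1
          (abs_le.1 (huc x (subset_closure hx))).2
        have h2 := hg x hx
        simp only
        linarith
    have hic : Integrable (fun _ : Euc n => 2 * c₀ ^ 2) (volume.restrict Ω) :=
      integrableOn_const hΩb.measure_lt_top.ne
    rw [integral_add hic hI, setIntegral_const, smul_eq_mul] at h1
    refine (h1.trans (add_le_add_right hle _)).trans ?_
    rw [hpow]
    have h8 : (ε ^ 8)⁻¹ = (ε ^ 4)⁻¹ * (ε ^ 4)⁻¹ := by rw [← mul_inv]; ring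
    rw [div_eq_mul_inv, div_eq_mul_inv, h8]
    generalize (ε ^ 4)⁻¹ = s at *
    generalize r ^ 2 = t at *
    have hs0 : 0 ≤ s := by linarith
    have ht0 : 0 ≤ t := by linarith
    have hss : s ≤ s * s := le_mul_of_one_le_right hs0 h4
    have hT : t * s ≤ t * (s * s) := mul_le_mul_of_nonneg_left hss ht0
    have hT1 : 1 ≤ t * (s * s) := by nlinarith
    have hs : s ≤ t * (s * s) := by nlinarith
    simp only [A]
    calc volume.real Ω * (2 * c₀ ^ 2) + (1 + c₀ ^ 2) ^ 3 * s * (volume.real Ω * t + C)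
        = 2 * c₀ ^ 2 * volume.real Ω * 1 +
            (1 + c₀ ^ 2) ^ 3 * (volume.real Ω * (t * s) + C * s) + 0 := by ring
      _ ≤ 2 * c₀ ^ 2 * volume.real Ω * (t * (s * s)) + (1 + c₀ ^ 2) ^ 3 *
            (volume.real Ω * (t * (s * s)) + C * (t * (s * s))) + t * (s * s) := by
          gcongr
          linarith
      _ = _ := by ring
  calc _ ≤ Real.sqrt (A * (ε ^ (-(4 + 1 / k))) ^ 2) := Real.sqrt_le_sqrt hbound
    _ = Real.sqrt A * ε ^ (-(4 + 1 / k)) := by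
        rw [Real.sqrt_mul hA.le, Real.sqrt_sq (by positivity)]
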